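/- Let S be a nonempty finite type, P : Matrix S S ℝ a row-stochastic matrix (all entries nonnegative and each row sums to 1), γ ∈ (0,1), and r, δ : S → ℝ with δ i ≥ 0 for all i. Suppose Q, Q̂ : S → ℝ satisfy Q = r + γ·P.mulVec Q and Q̂ = r + γ·P.mulVec Q̂ − δ. Then Q̂ i ≤ Q i for all i ∈ S; moreover Q i − Q̂ i = ((1 − γ•P)⁻¹.mulVec δ) i for all i. -/

import Mathlib

open scoped Matrix

/-- Minimum principle: a vector dominating its discounted average under a row-stochastic matrix
is nonnegative. -/
theorem Matrix.nonneg_of_smul_mulVec_le {S : Type*} [Fintype S] {P : Matrix S S ℝ}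
    (hP0 : ∀ i j, 0 ≤ P i j) (hP1 : ∀ i, ∑ j, P i j = 1) {γ : ℝ} (hγ0 : 0 ≤ γ) (hγ1 : γ < 1)
    {v : S → ℝ} (hv : ∀ i, γ * (P *ᵥ v) i ≤ v i) (i : S) : 0 ≤ v i := by
  have : Nonempty S := ⟨i⟩
  obtain ⟨k, hk⟩ := Finite.exists_min v
  have hmin : v k ≤ (P *ᵥ v) k :=
    calc v k = ∑ j, P k j * v k := by rw [← Finset.sum_mul, hP1, one_mul]
      _ ≤ ∑ j, P k j * v j :=
        Finset.sum_le_sum fun j _ => mul_le_mul_of_nonneg_left (hk j) (hP0 k j)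
  have hvk : 0 ≤ v k := by nlinarith [hv k, mul_le_mul_of_nonneg_left hmin hγ0]
  exact hvk.trans (hk i)

/-- The resolvent matrix `1 - γ • P` of a row-stochastic matrix is invertible for `0 ≤ γ < 1`. -/
theorem Matrix.isUnit_one_sub_smul_of_stochastic {S : Type*} [Fintype S] [DecidableEq S]
    {P : Matrix S S ℝ} (hP0 : ∀ i j, 0 ≤ P i j) (hP1 : ∀ i, ∑ j, P i j = 1)
    {γ : ℝ} (hγ0 : 0 ≤ γ) (hγ1 : γ < 1) : IsUnit (1 - γ • P) := by
  rw [← Matrix.mulVec_injective_iff_isUnit]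
  intro v w hvw
  have key : ∀ i, v i - γ * (P *ᵥ v) i = w i - γ * (P *ᵥ w) i := fun i => by
    simpa [Matrix.sub_mulVec, Matrix.smul_mulVec] using congrFun hvw i
  ext i
  have h₁ := Matrix.nonneg_of_smul_mulVec_le hP0 hP1 hγ0 hγ1 (v := v - w)
    (fun j => by rw [Matrix.mulVec_sub]; simp only [Pi.sub_apply]; linarith [key j]) i
  have h₂ := Matrix.nonneg_of_smul_mulVec_le hP0 hP1 hγ0 hγ1 (v := w - v)
    (fun j => by rw [Matrix.mulVec_sub]; simp only [Pi.sub_apply]; linarith [key j]) i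
  simp only [Pi.sub_apply] at h₁ h₂
  linarith

/-- No-sampling-error conservatism: subtracting a nonnegative penalty δ from
the exact Bellman backup yields a pointwise lower bound Q̂ ≤ Q, with gap
Q − Q̂ = (1 − γ•P)⁻¹ δ. -/
theorem aclql_exact_conservatism
    (S : Type) [Fintype S] [Nonempty S] [DecidableEq S]
    (P : Matrix S S ℝ)
    (hP0 : ∀ i j, 0 ≤ P i j) (hP1 : ∀ i, ∑ j, P i j = 1)
    (γ : ℝ) (hγ : γ ∈ Set.Ioo (0 : ℝ) 1)
    (r δ : S → ℝ) (hδ : ∀ i, 0 ≤ δ i)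
    (Q Qhat : S → ℝ)
    (hQ : ∀ i, Q i = r i + γ * P.mulVec Q i)
    (hQhat : ∀ i, Qhat i = r i + γ * P.mulVec Qhat i - δ i) :
    (∀ i, Qhat i ≤ Q i) ∧
      (∀ i, Q i - Qhat i = ((1 - γ • P)⁻¹).mulVec δ i) := by
  have gap : ∀ i, (Q - Qhat) i - γ * (P *ᵥ (Q - Qhat)) i = δ i := fun i => by
    rw [Matrix.mulVec_sub]
    simp only [Pi.sub_apply]
    linarith [hQ i, hQhat i]
  refine ⟨fun i => sub_nonneg.mp ?_, fun i => ?_⟩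
  · exact Matrix.nonneg_of_smul_mulVec_le hP0 hP1 hγ.1.le hγ.2 (v := Q - Qhat)
      (fun j => by linarith [gap j, hδ j]) i
  · have hδ_eq : δ = (1 - γ • P) *ᵥ (Q - Qhat) := by
      ext j
      rw [← gap j, Matrix.sub_mulVec, Matrix.one_mulVec, Matrix.smul_mulVec]
      rfl
    have hdet := (Matrix.isUnit_iff_isUnit_det _).mp
      (Matrix.isUnit_one_sub_smul_of_stochastic hP0 hP1 hγ.1.le hγ.2)
    rw [hδ_eq, Matrix.mulVec_mulVec, Matrix.nonsing_inv_mul _ hdet, Matrix.one_mulVec]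
    rfl
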